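/- Suppose p satisfies Y ⊥ A | (Z,C). Let Ē : 𝒵 × 𝒞 → ℝ be any function, let q_Z : 𝒵 × 𝒜 × 𝒞 → ℝ satisfy q_Z(z|a,c) > 0 and Σ_z q_Z(z|a,c) = 1 for all (a,c), and let q_A : 𝒜 × 𝒞 → ℝ satisfy q_A(a|c) > 0 and Σ_a q_A(a|c) = 1 for all c. Set θ₀ = Σ_{z,c} E(Y|z,c)·(p(z|a⋆,c) − p(z|a°,c))·p(c) and define φ̄(c,a,z,y) = (y − Ē(z,c))·(q_Z(z|a⋆,c) − q_Z(z|a°,c))/(Σ_ā q_A(ā|c)·q_Z(z|ā,c)) + (Ē(z,c) − Σ_{z'} Ē(z',c)·q_Z(z'|a,c))·(1[a=a⋆] − 1[a=a°])/q_A(a|c) + Σ_{z'} Ē(z',c)·(q_Z(z'|a⋆,c) − q_Z(z'|a°,c)) − θ₀. If at least one of the following holds: (i) Ē(z,c) = E(Y|z,c) for all (z,c) and q_A(a|c) = p(a|c) for all (a,c); (ii) Ē(z,c) = E(Y|z,c) for all (z,c) and q_Z(z|a,c) = p(z|a,c) for all (z,a,c); (iii) q_Z(z|a,c) = p(z|a,c)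 for all (z,a,c) and q_A(a|c) = p(a|c) for all (a,c) — then E_p(φ̄) = 0. -/

import Mathlib

open Finset

noncomputable section

namespace TwoDoorPaper

/-- Indicator 1[a = b] as a real number. -/
def ind {A : Type*} [DecidableEq A] (a b : A) : ℝ := if a = b then 1 else 0

variable {C A Z Y : Type*} [Fintype C] [Fintype A] [Fintype Z] [Fintype Y]

/-- Marginal p(c). -/
def pC (p : C → A → Z → Y → ℝ) (c : C) : ℝ := ∑ a, ∑ z, ∑ y, p c a z y

/-- Marginal p(a,c). -/
def pAC (p : C → A → Z → Y → ℝ) (a : A) (c : C) : ℝ := ∑ z, ∑ y, p c a z y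

/-- Marginal p(c,a,z). -/
def pCAZ (p : C → A → Z → Y → ℝ) (c : C) (a : A) (z : Z) : ℝ := ∑ y, p c a z y

/-- Marginal p(a). -/
def pA (p : C → A → Z → Y → ℝ) (a : A) : ℝ := ∑ c, pAC p a c

/-- Marginal p(a,z). -/
def pAZ (p : C → A → Z → Y → ℝ) (a : A) (z : Z) : ℝ := ∑ c, pCAZ p c a z

/-- Marginal p(z,c). -/
def pZC (p : C → A → Z → Y → ℝ) (z : Z) (c : C) : ℝ := ∑ a, pCAZ p c a z

/-- Conditional p(a|c). -/
def cA (p : C → A → Z → Y → ℝ) (a : A) (c : C) : ℝ := pAC p a c / pC p c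

/-- Conditional p(z|a,c). -/
def cZ (p : C → A → Z → Y → ℝ) (z : Z) (a : A) (c : C) : ℝ := pCAZ p c a z / pAC p a c

/-- Conditional p(z|a). -/
def cZA (p : C → A → Z → Y → ℝ) (z : Z) (a : A) : ℝ := pAZ p a z / pA p a

/-- Conditional p(y|a,z,c). -/
def cY (p : C → A → Z → Y → ℝ) (a : A) (z : Z) (c : C) (y : Y) : ℝ := p c a z y / pCAZ p c a z

/-- Conditional p(y|a,z). -/
def cYaz (p : C → A → Z → Y → ℝ) (a : A) (z : Z) (y : Y) : ℝ := (∑ c, p c a z y) / pAZ p a z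

/-- Conditional p(y|a,c). -/
def cYac (p : C → A → Z → Y → ℝ) (a : A) (c : C) (y : Y) : ℝ := (∑ z, p c a z y) / pAC p a c

/-- Conditional p(y|z,c). -/
def cYzc (p : C → A → Z → Y → ℝ) (z : Z) (c : C) (y : Y) : ℝ := (∑ a, p c a z y) / pZC p z c

/-- Conditional expectation E(Y|a,z,c). -/
def EYazc (p : C → A → Z → Y → ℝ) (yv : Y → ℝ) (a : A) (z : Z) (c : C) : ℝ :=
  ∑ y, yv y * cY p a z c y

/-- Conditional variance var(Y|a,z,c). -/
def VYazc (p : C → A → Z → Y → ℝ) (yv : Y → ℝ) (a : A) (z : Z) (c : C) : ℝ :=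
  (∑ y, (yv y) ^ 2 * cY p a z c y) - (EYazc p yv a z c) ^ 2

/-- Conditional expectation E(Y|a,z). -/
def EYaz (p : C → A → Z → Y → ℝ) (yv : Y → ℝ) (a : A) (z : Z) : ℝ :=
  ∑ y, yv y * cYaz p a z y

/-- Conditional variance var(Y|a,z). -/
def VYaz (p : C → A → Z → Y → ℝ) (yv : Y → ℝ) (a : A) (z : Z) : ℝ :=
  (∑ y, (yv y) ^ 2 * cYaz p a z y) - (EYaz p yv a z) ^ 2

/-- Conditional expectation E(Y|a,c). -/
def EYac (p : C → A → Z → Y → ℝ) (yv : Y → ℝ) (a : A) (c : C) : ℝ :=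
  ∑ y, yv y * cYac p a c y

/-- Conditional expectation E(Y|z,c). -/
def EYzc (p : C → A → Z → Y → ℝ) (yv : Y → ℝ) (z : Z) (c : C) : ℝ :=
  ∑ y, yv y * cYzc p z c y

/-- Conditional variance var(Y|z,c). -/
def VYzc (p : C → A → Z → Y → ℝ) (yv : Y → ℝ) (z : Z) (c : C) : ℝ :=
  (∑ y, (yv y) ^ 2 * cYzc p z c y) - (EYzc p yv z c) ^ 2

/-- var(C|a) for real-valued covariates. -/
def VCgivenA (p : C → A → Z → Y → ℝ) (cv : C → ℝ) (a : A) : ℝ :=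
  (∑ c, (cv c) ^ 2 * (pAC p a c / pA p a)) - (∑ c, cv c * (pAC p a c / pA p a)) ^ 2

/-- var(Z|a) for real-valued mediators. -/
def VZgivenA (p : C → A → Z → Y → ℝ) (zv : Z → ℝ) (a : A) : ℝ :=
  (∑ z, (zv z) ^ 2 * cZA p z a) - (∑ z, zv z * cZA p z a) ^ 2

/-- Expectation of f under p. -/
def Ep (p : C → A → Z → Y → ℝ) (f : C → A → Z → Y → ℝ) : ℝ :=
  ∑ c, ∑ a, ∑ z, ∑ y, p c a z y * f c a z y

/-- Variance of f under p. -/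
def Varp (p : C → A → Z → Y → ℝ) (f : C → A → Z → Y → ℝ) : ℝ :=
  (∑ c, ∑ a, ∑ z, ∑ y, p c a z y * (f c a z y) ^ 2) - (Ep p f) ^ 2

/-- p is a strictly positive probability mass function. -/
def IsPMF (p : C → A → Z → Y → ℝ) : Prop :=
  (∀ c a z y, 0 < p c a z y) ∧ (∑ c, ∑ a, ∑ z, ∑ y, p c a z y) = 1

/-- Y ⊥ A | (Z, C): p(y|a,z,c) does not depend on a. -/
def IndepYA (p : C → A → Z → Y → ℝ) : Prop :=
  ∀ a a' z c y, cY p a z c y = cY p a' z c y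

/-- Z ⊥ C | A: p(z|a,c) = p(z|a) for all c. -/
def IndepZC (p : C → A → Z → Y → ℝ) : Prop :=
  ∀ z a c, cZ p z a c = cZA p z a

/-- θ_td. -/
def thTD (p : C → A → Z → Y → ℝ) (yv : Y → ℝ) (astar acirc : A) : ℝ :=
  ∑ z, ∑ c, ∑ ab, EYazc p yv ab z c * (cZ p z astar c - cZ p z acirc c) * cA p ab c * pC p c

/-- The two-door efficient influence function φ_td. -/
def phiTD [DecidableEq A] (p : C → A → Z → Y → ℝ) (yv : Y → ℝ) (astar acirc : A)
    (c : C) (a : A) (z : Z) (y : Y) : ℝ :=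
  (yv y - EYazc p yv a z c) * (cZ p z astar c - cZ p z acirc c) / cZ p z a c
  + ((∑ ab, EYazc p yv ab z c * cA p ab c)
      - ∑ ab, ∑ z', EYazc p yv ab z' c * cZ p z' a c * cA p ab c)
    * (ind a astar - ind a acirc) / cA p a c
  + (∑ z', EYazc p yv a z' c * (cZ p z' astar c - cZ p z' acirc c))
  - thTD p yv astar acirc

/-- θ_bd. -/
def thBD (p : C → A → Z → Y → ℝ) (yv : Y → ℝ) (astar acirc : A) : ℝ :=
  ∑ c, pC p c * (EYac p yv astar c - EYac p yv acirc c)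

/-- The back-door efficient influence function φ_bd. -/
def phiBD [DecidableEq A] (p : C → A → Z → Y → ℝ) (yv : Y → ℝ) (astar acirc : A)
    (c : C) (a : A) (_z : Z) (y : Y) : ℝ :=
  ind a astar * (yv y - EYac p yv astar c) / cA p astar c
  - ind a acirc * (yv y - EYac p yv acirc c) / cA p acirc c
  + EYac p yv astar c - EYac p yv acirc c - thBD p yv astar acirc

/-- θ° (for the combined back-door/two-door model). -/
def thBDTD (p : C → A → Z → Y → ℝ) (yv : Y → ℝ) (astar acirc : A) : ℝ :=
  ∑ z, ∑ c, EYzc p yv z c * (cZ p z astar c - cZ p z acirc c) * pC p c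

/-- The efficient influence function φ_bdtd. -/
def phiBDTD [DecidableEq A] (p : C → A → Z → Y → ℝ) (yv : Y → ℝ) (astar acirc : A)
    (c : C) (a : A) (z : Z) (y : Y) : ℝ :=
  (yv y - EYzc p yv z c) * (cZ p z astar c - cZ p z acirc c) / (∑ ab, cZ p z ab c * cA p ab c)
  + (EYzc p yv z c - ∑ z', EYzc p yv z' c * cZ p z' a c)
    * (ind a astar - ind a acirc) / cA p a c
  + (∑ z', EYzc p yv z' c * (cZ p z' astar c - cZ p z' acirc c))
  - thBDTD p yv astar acirc

/-- ψ_fd(ă). -/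
def psiFD (p : C → A → Z → Y → ℝ) (yv : Y → ℝ) (abreve : A) : ℝ :=
  ∑ z, ∑ ab, EYaz p yv ab z * pA p ab * cZA p z abreve

/-- θ_fd. -/
def thFD (p : C → A → Z → Y → ℝ) (yv : Y → ℝ) (astar acirc : A) : ℝ :=
  psiFD p yv astar - psiFD p yv acirc

/-- The front-door efficient influence function φ_fd. -/
def phiFD [DecidableEq A] (p : C → A → Z → Y → ℝ) (yv : Y → ℝ) (astar acirc : A)
    (_c : C) (a : A) (z : Z) (y : Y) : ℝ :=
  (yv y - EYaz p yv a z) * (cZA p z astar - cZA p z acirc) / cZA p z a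
  + ind a astar * ((∑ ab, EYaz p yv ab z * pA p ab) - psiFD p yv astar) / pA p astar
  - ind a acirc * ((∑ ab, EYaz p yv ab z * pA p ab) - psiFD p yv acirc) / pA p acirc
  + (∑ z', EYaz p yv a z' * (cZA p z' astar - cZA p z' acirc))
  - thFD p yv astar acirc

/-- θ' (for the combined front-door/two-door model). -/
def thFDTD (p : C → A → Z → Y → ℝ) (yv : Y → ℝ) (astar acirc : A) : ℝ :=
  ∑ c, ∑ ab, ∑ z, EYazc p yv ab z c * (cZA p z astar - cZA p z acirc) * cA p ab c * pC p c

/-- The efficient influence function φ_fdtd. -/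
def phiFDTD [DecidableEq A] (p : C → A → Z → Y → ℝ) (yv : Y → ℝ) (astar acirc : A)
    (c : C) (a : A) (z : Z) (y : Y) : ℝ :=
  (yv y - EYazc p yv a z c) * (cZA p z astar - cZA p z acirc) / cZA p z a
  + (∑ c', ((∑ ab, EYazc p yv ab z c' * cA p ab c')
        - ∑ ab, ∑ z', EYazc p yv ab z' c' * cZA p z' a * cA p ab c') * pC p c')
    * (ind a astar - ind a acirc) / pA p a
  + (∑ z', EYazc p yv a z' c * (cZA p z' astar - cZA p z' acirc))
  - thFDTD p yv astar acirc

/-- θ'' (for the combined back/front/two-door model). -/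
def thBDFDTD (p : C → A → Z → Y → ℝ) (yv : Y → ℝ) (astar acirc : A) : ℝ :=
  ∑ c, ∑ z, EYzc p yv z c * (cZA p z astar - cZA p z acirc) * pC p c

/-- The efficient influence function φ_bdfdtd. -/
def phiBDFDTD [DecidableEq A] (p : C → A → Z → Y → ℝ) (yv : Y → ℝ) (astar acirc : A)
    (c : C) (a : A) (z : Z) (y : Y) : ℝ :=
  (yv y - EYzc p yv z c) * (cZA p z astar - cZA p z acirc) / (∑ ab, cA p ab c * cZA p z ab)
  + (∑ c', (EYzc p yv z c' - ∑ z', EYzc p yv z' c' * cZA p z' a) * pC p c')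
    * (ind a astar - ind a acirc) / (∑ c', pC p c' * cA p a c')
  + (∑ z', EYzc p yv z' c * (cZA p z' astar - cZA p z' acirc))
  - thBDFDTD p yv astar acirc

section Factorization

variable {C A Z Y : Type*} {p : C → A → Z → Y → ℝ}

theorem pCAZ_pos [Fintype Y] [Nonempty Y] (h : ∀ c a z y, 0 < p c a z y) (c : C) (a : A) (z : Z) :
    0 < pCAZ p c a z :=
  sum_pos (fun y _ => h c a z y) univ_nonempty

theorem pAC_pos [Fintype Z] [Fintype Y] [Nonempty Z] [Nonempty Y]
    (h : ∀ c a z y, 0 < p c a z y) (a : A) (c : C) : 0 < pAC p a c :=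
  sum_pos (fun z _ => pCAZ_pos h c a z) univ_nonempty

theorem pC_pos [Fintype A] [Fintype Z] [Fintype Y] [Nonempty A] [Nonempty Z] [Nonempty Y]
    (h : ∀ c a z y, 0 < p c a z y) (c : C) : 0 < pC p c :=
  sum_pos (fun a _ => pAC_pos h a c) univ_nonempty

theorem pZC_pos [Fintype A] [Fintype Y] [Nonempty A] [Nonempty Y]
    (h : ∀ c a z y, 0 < p c a z y) (z : Z) (c : C) : 0 < pZC p z c :=
  sum_pos (fun a _ => pCAZ_pos h c a z) univ_nonempty

theorem sum_pCAZ_eq_pAC [Fintype Z] [Fintype Y] (a : A) (c : C) :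
    ∑ z, pCAZ p c a z = pAC p a c := rfl

/-- The joint law factors as p(c,a,z) p(y|z,c) when Y ⊥ A | (Z, C). -/
theorem eq_pCAZ_mul_cYzc [Fintype A] [Fintype Y] [Nonempty A] [Nonempty Y]
    (h : ∀ c a z y, 0 < p c a z y) (hind : IndepYA p) (c : C) (a : A) (z : Z) (y : Y) :
    p c a z y = pCAZ p c a z * cYzc p z c y := by
  have hmul : ∀ a', p c a' z y = pCAZ p c a' z * cY p a z c y := fun a' => by
    rw [hind a a' z c y, cY, mul_div_cancel₀ _ (pCAZ_pos h c a' z).ne']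
  have hc : cYzc p z c y = cY p a z c y := by
    rw [cYzc, div_eq_iff (pZC_pos h z c).ne', pZC, mul_sum]
    exact sum_congr rfl fun a' _ => by rw [hmul a', mul_comm]
  rw [hc, ← hmul a]

theorem sum_mul_outcome [Fintype A] [Fintype Y] [Nonempty A] [Nonempty Y]
    (h : ∀ c a z y, 0 < p c a z y) (hind : IndepYA p) (yv : Y → ℝ) (c : C) (a : A) (z : Z) :
    ∑ y, p c a z y * yv y = pCAZ p c a z * EYzc p yv z c := by
  rw [EYzc, mul_sum]
  exact sum_congr rfl fun y _ => by rw [eq_pCAZ_mul_cYzc h hind c a z y]; ring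

theorem sum_mul_affine_outcome [Fintype A] [Fintype Y] [Nonempty A] [Nonempty Y]
    (h : ∀ c a z y, 0 < p c a z y) (hind : IndepYA p) (yv : Y → ℝ) (c : C) (a : A) (z : Z) (e g k : ℝ) :
    ∑ y, p c a z y * ((yv y - e) * g + k)
      = pCAZ p c a z * ((EYzc p yv z c - e) * g + k) := by
  have hsplit : ∀ y, p c a z y * ((yv y - e) * g + k)
      = p c a z y * yv y * g + p c a z y * (k - e * g) := fun y => by ring
  simp only [hsplit, sum_add_distrib, ← sum_mul, sum_mul_outcome h hind yv]
  rw [show ∑ y, p c a z y = pCAZ p c a z from rfl]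
  ring

theorem pCAZ_eq_pAC_mul_cZ [Fintype Z] [Fintype Y] [Nonempty Z] [Nonempty Y]
    (h : ∀ c a z y, 0 < p c a z y) (c : C) (a : A) (z : Z) :
    pCAZ p c a z = pAC p a c * cZ p z a c := by
  rw [cZ, mul_div_cancel₀ _ (pAC_pos h a c).ne']

theorem pAC_eq_pC_mul_cA [Fintype A] [Fintype Z] [Fintype Y] [Nonempty A] [Nonempty Z]
    [Nonempty Y] (h : ∀ c a z y, 0 < p c a z y) (a : A) (c : C) :
    pAC p a c = pC p c * cA p a c := by
  rw [cA, mul_div_cancel₀ _ (pC_pos h c).ne']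

theorem pZC_eq_pC_mul_sum [Fintype A] [Fintype Z] [Fintype Y] [Nonempty A] [Nonempty Z]
    [Nonempty Y] (h : ∀ c a z y, 0 < p c a z y) (z : Z) (c : C) :
    pZC p z c = pC p c * ∑ a, cA p a c * cZ p z a c := by
  rw [pZC, mul_sum]
  exact sum_congr rfl fun a _ => by
    rw [pCAZ_eq_pAC_mul_cZ h, pAC_eq_pC_mul_cA h, mul_assoc]

theorem sum_mul_ind_sub_ind [Fintype A] [DecidableEq A] (f : A → ℝ) (a₁ a₂ : A) :
    ∑ a, f a * (ind a a₁ - ind a a₂) = f a₁ - f a₂ := by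
  simp [ind, mul_sub]

/-- The expectation of an augmented estimating function, within the stratum C = c. -/
theorem sum_stratum_eq [Fintype A] [Fintype Z] [Fintype Y] [Nonempty A] [Nonempty Z]
    [Nonempty Y] (h : ∀ c a z y, 0 < p c a z y) (hind : IndepYA p) (yv : Y → ℝ) (c : C) (e g : Z → ℝ) (r w : A → ℝ) (t k : ℝ) :
    ∑ a, ∑ z, ∑ y, p c a z y * ((yv y - e z) * g z + (e z - r a) * w a + t - k)
      = ∑ z, pZC p z c * ((EYzc p yv z c - e z) * g z)
        + ∑ a, pAC p a c * (∑ z, e z * cZ p z a c - r a) * w a + pC p c * (t - k) := by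
  have hy : ∀ a z, ∑ y, p c a z y * ((yv y - e z) * g z + (e z - r a) * w a + t - k)
      = pCAZ p c a z * ((EYzc p yv z c - e z) * g z)
        + (pAC p a c * (e z * cZ p z a c) * w a - pCAZ p c a z * (r a * w a))
        + pCAZ p c a z * (t - k) := fun a z => by
    simp only [add_assoc, add_sub_assoc, sum_mul_affine_outcome h hind]
    rw [pCAZ_eq_pAC_mul_cZ h]
    ring
  simp only [hy, sum_add_distrib, sum_sub_distrib, ← sum_mul, ← mul_sum, sum_pCAZ_eq_pAC]
  rw [sum_comm]
  simp only [← sum_mul, show ∀ z, ∑ a, pCAZ p c a z = pZC p z c from fun _ => rfl]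
  rw [show ∑ a, pAC p a c = pC p c from rfl]
  congr 2
  rw [← sum_sub_distrib]
  exact sum_congr rfl fun a _ => by ring

end Factorization

/-- Robustness of the estimating equation based on φ_bdtd to misspecified nuisance
models (Theorem 2, consistency part). -/
theorem stmt16
    {C A Z Y : Type*} [Fintype C] [Fintype A] [Fintype Z] [Fintype Y]
    [Nonempty C] [Nonempty A] [Nonempty Z] [Nonempty Y] [DecidableEq A]
    (p : C → A → Z → Y → ℝ) (yv : Y → ℝ) (hyv : Function.Injective yv)
    (hp : IsPMF p) (astar acirc : A) (hne : astar ≠ acirc)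
    (hind : IndepYA p)
    (Eb : Z → C → ℝ)
    (qZ : Z → A → C → ℝ) (hqZpos : ∀ z a c, 0 < qZ z a c) (hqZsum : ∀ a c, (∑ z, qZ z a c) = 1)
    (qA : A → C → ℝ) (hqApos : ∀ a c, 0 < qA a c) (hqAsum : ∀ c, (∑ a, qA a c) = 1)
    (hcase :
      ((∀ z c, Eb z c = EYzc p yv z c) ∧ (∀ a c, qA a c = cA p a c))
      ∨ ((∀ z c, Eb z c = EYzc p yv z c) ∧ (∀ z a c, qZ z a c = cZ p z a c))
      ∨ ((∀ z a c, qZ z a c = cZ p z a c) ∧ (∀ a c, qA a c = cA p a c))) :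
    Ep p (fun c a z y =>
      (yv y - Eb z c) * (qZ z astar c - qZ z acirc c) / (∑ ab, qA ab c * qZ z ab c)
      + (Eb z c - ∑ z', Eb z' c * qZ z' a c) * (ind a astar - ind a acirc) / qA a c
      + (∑ z', Eb z' c * (qZ z' astar c - qZ z' acirc c))
      - thBDTD p yv astar acirc) = 0 := by
  have h := hp.1
  have hstratum : ∀ c, ∑ a, ∑ z, ∑ y, p c a z y *
      ((yv y - Eb z c) * (qZ z astar c - qZ z acirc c) / (∑ ab, qA ab c * qZ z ab c)
      + (Eb z c - ∑ z', Eb z' c * qZ z' a c) * (ind a astar - ind a acirc) / qA a c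
      + (∑ z', Eb z' c * (qZ z' astar c - qZ z' acirc c))
      - thBDTD p yv astar acirc)
      = ∑ z, EYzc p yv z c * (cZ p z astar c - cZ p z acirc c) * pC p c
        - pC p c * thBDTD p yv astar acirc := by
    intro c
    simp only [mul_div_assoc]
    rw [sum_stratum_eq h hind yv c (fun z => Eb z c)
      (fun z => (qZ z astar c - qZ z acirc c) / ∑ ab, qA ab c * qZ z ab c)
      (fun a => ∑ z', Eb z' c * qZ z' a c) (fun a => (ind a astar - ind a acirc) / qA a c),
      ← sum_mul]
    rcases hcase with ⟨hE, hA⟩ | ⟨hE, hZ⟩ | ⟨hZ, hA⟩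
    · have hw : ∀ a, pAC p a c * (∑ z, Eb z c * cZ p z a c - ∑ z, Eb z c * qZ z a c)
            * ((ind a astar - ind a acirc) / qA a c)
          = pC p c * (∑ z, Eb z c * cZ p z a c - ∑ z, Eb z c * qZ z a c)
            * (ind a astar - ind a acirc) := fun a => by
        have hne : qA a c ≠ 0 := (hqApos a c).ne'
        rw [pAC_eq_pC_mul_cA h, ← hA]
        field_simp
      simp only [hw, sum_mul_ind_sub_ind]
      simp only [hE, sub_self, zero_mul, mul_zero, sum_const_zero, mul_sub, sum_sub_distrib]
      ring
    · simp only [hE, hZ, sub_self, zero_mul, mul_zero, sum_const_zero]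
      ring
    · have hT : ∀ z, pZC p z c * ((EYzc p yv z c - Eb z c)
          * ((cZ p z astar c - cZ p z acirc c) / ∑ ab, cA p ab c * cZ p z ab c))
          = pC p c * ((EYzc p yv z c - Eb z c) * (cZ p z astar c - cZ p z acirc c)) := fun z => by
        have hpos : pZC p z c ≠ 0 := (pZC_pos h z c).ne'
        rw [pZC_eq_pC_mul_sum h] at hpos ⊢
        have hne := right_ne_zero_of_mul hpos
        field_simp
      simp only [hZ, hA, hT, sub_self, mul_zero, zero_mul, sum_const_zero]
      simp only [← mul_sum, sub_mul, sum_sub_distrib]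
      ring
  have hone : ∑ c, pC p c = 1 := hp.2
  rw [Ep, sum_congr rfl fun c _ => hstratum c, sum_sub_distrib, ← sum_mul, hone, one_mul,
    sub_eq_zero, thBDTD, sum_comm]

end TwoDoorPaper
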